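/- Let H ∈ (0,1), K ∈ (0,1] with HK ∈ (1/2, 1), and set Q_{H,K}(s,t) = 2^{2−K} H² K (K−1) (t^{2H} + s^{2H})^{K−2} (s t)^{2H−1} + 2^{1−K} H K (2HK−1) |t − s|^{2HK−2} for s, t > 0 with s ≠ t. Let A < 0 < B, let G : ℝ → ℝ be a bounded measurable function vanishing outside [A,B], and let t > 0 be fixed. Then lim_{φ → 0⁺} φ^{2−2HK} ∫_A^B ∫_A^B G(u) G(v) Q_{H,K}(t + φ u, t + φ v) du dv = 2^{1−K} H K (2HK−1) ∫_A^B ∫_A^B G(u) G(v) |u − v|^{2HK−2} du dv. -/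

import Mathlib

open MeasureTheory Real Filter

/-- The power `|x| ^ r` with `r > -1` is locally integrable on the line. -/
theorem intervalIntegrable_abs_rpow {r : ℝ} (hr : -1 < r) (a b : ℝ) :
    IntervalIntegrable (fun x : ℝ => |x| ^ r) volume a b := by
  have hpos : ∀ c : ℝ, 0 ≤ c → IntervalIntegrable (fun x : ℝ => |x| ^ r) volume 0 c := by
    intro c hc
    refine (intervalIntegral.intervalIntegrable_rpow' hr (a := 0) (b := c)).congr ?_
    intro x hx
    rw [Set.uIoc_of_le hc] at hx
    simp only [abs_of_pos hx.1]
  have hall : ∀ c : ℝ, IntervalIntegrable (fun x : ℝ => |x| ^ r) volume 0 c := by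
    intro c
    rcases le_total 0 c with hc | hc
    · exact hpos c hc
    · have h := (hpos (-c) (by linarith)).comp_mul_left (c := -1)
      simpa using h
  exact (hall a).symm.trans (hall b)

/-- Translated and reflected version of `intervalIntegrable_abs_rpow`. -/
theorem intervalIntegrable_abs_sub_rpow {r : ℝ} (hr : -1 < r) (u a b : ℝ) :
    IntervalIntegrable (fun v : ℝ => |u - v| ^ r) volume a b := by
  simpa using (intervalIntegrable_abs_rpow hr (u - a) (u - b)).comp_sub_left u

/-- The integral of `|u - v| ^ r` over `v ∈ [a, b]` is bounded uniformly in `u ∈ [a, b]`. -/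
theorem integral_abs_sub_rpow_le {r : ℝ} (hr : -1 < r) {a b u : ℝ} (hu : u ∈ Set.Icc a b) :
    ∫ v in a..b, |u - v| ^ r ≤ ∫ w in (a - b)..(b - a), |w| ^ r := by
  rw [intervalIntegral.integral_comp_sub_left (fun w : ℝ => |w| ^ r) u]
  refine intervalIntegral.integral_mono_interval ?_ ?_ ?_ ?_
    (intervalIntegrable_abs_rpow hr _ _)
  · linarith [hu.1]
  · linarith [hu.1, hu.2]
  · linarith [hu.2]
  · exact Eventually.of_forall fun x => rpow_nonneg (abs_nonneg x) r

/-- A partial interval integral of a jointly measurable function is interval integrable as soon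
as it is bounded. -/
theorem intervalIntegrable_integral_of_bounded {f : ℝ → ℝ → ℝ}
    (hf : Measurable (Function.uncurry f))
    {a b M : ℝ} (hab : a ≤ b) (hM : ∀ u ∈ Set.Icc a b, |∫ v in a..b, f u v| ≤ M) :
    IntervalIntegrable (fun u => ∫ v in a..b, f u v) volume a b := by
  have hmeas : StronglyMeasurable (fun u => ∫ v in a..b, f u v) := by
    simp only [intervalIntegral.integral_of_le hab]
    exact hf.stronglyMeasurable.integral_prod_right
  refine (intervalIntegrable_const (c := M)).mono_fun' hmeas.aestronglyMeasurable ?_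
  rw [Set.uIoc_of_le hab]
  filter_upwards [ae_restrict_mem measurableSet_Ioc] with u hu
  exact hM u (Set.Ioc_subset_Icc_self hu)

/-- The part of the mixed derivative of the bifractional covariance that is smooth off the
axes is bounded near any diagonal point `(t, t)` with `t > 0`. -/
theorem exists_bound_add_rpow_mul_rpow (p q e c t : ℝ) (ht : 0 < t) :
    ∃ M, ∀ x ∈ Set.Icc (t / 2) (2 * t), ∀ y ∈ Set.Icc (t / 2) (2 * t),
      |c * (y ^ p + x ^ p) ^ q * (x * y) ^ e| ≤ M := by
  have hcont : ContinuousOn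
      (fun z : ℝ × ℝ => c * (z.2 ^ p + z.1 ^ p) ^ q * (z.1 * z.2) ^ e)
      (Set.Icc (t / 2) (2 * t) ×ˢ Set.Icc (t / 2) (2 * t)) := by
    intro z hz
    have h1 : 0 < z.1 := lt_of_lt_of_le (by positivity) hz.1.1
    have h2 : 0 < z.2 := lt_of_lt_of_le (by positivity) hz.2.1
    apply ContinuousAt.continuousWithinAt
    refine (continuousAt_const.mul (ContinuousAt.rpow_const ?_ (Or.inl (by positivity)))).mul
      (ContinuousAt.rpow_const (by fun_prop) (Or.inl (by positivity)))
    exact (continuousAt_snd.rpow_const (Or.inl h2.ne')).add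
      (continuousAt_fst.rpow_const (Or.inl h1.ne'))
  obtain ⟨M, hM⟩ := (isCompact_Icc.prod isCompact_Icc).exists_bound_of_continuousOn hcont
  exact ⟨M, fun x hx y hy => hM (x, y) ⟨hx, hy⟩⟩

/-- Asymptotic variance identification: with `Q_{H,K}` the mixed second partial
derivative of the bifractional Brownian covariance (`HK ∈ (1/2,1)`) and `t > 0` fixed,
`φ^{2-2HK} ∫_A^B ∫_A^B G(u)G(v) Q_{H,K}(t+φu, t+φv) du dv` converges, as `φ → 0⁺`, to
`2^{1-K} H K (2HK-1) ∫_A^B ∫_A^B G(u)G(v)|u-v|^{2HK-2} du dv`. -/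
theorem bifBm_kernel_asymptotic_variance
    (H K : ℝ) (hH : H ∈ Set.Ioo (0:ℝ) 1) (hK : K ∈ Set.Ioc (0:ℝ) 1)
    (hHK : H * K ∈ Set.Ioo (1/2 : ℝ) 1)
    (Q : ℝ → ℝ → ℝ)
    (hQ : ∀ s t : ℝ, 0 < s → 0 < t → s ≠ t →
      Q s t = 2 ^ (2-K) * H^2 * K * (K-1) * (t ^ (2*H) + s ^ (2*H)) ^ (K-2)
            * (s*t) ^ (2*H-1)
          + 2 ^ (1-K) * H * K * (2*H*K - 1) * |t - s| ^ (2*H*K - 2))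
    (A B t : ℝ) (hA : A < 0) (hB : 0 < B) (ht : 0 < t)
    (G : ℝ → ℝ) (hG_meas : Measurable G) (hG_bdd : ∃ C, ∀ u, |G u| ≤ C)
    (hG_supp : ∀ u ∉ Set.Icc A B, G u = 0) :
    Tendsto
      (fun φ : ℝ => φ ^ (2 - 2*H*K) *
        ∫ u in A..B, ∫ v in A..B, G u * G v * Q (t + φ * u) (t + φ * v))
      (nhdsWithin 0 (Set.Ioi 0))
      (nhds (2 ^ (1-K) * H * K * (2*H*K - 1) *
        ∫ u in A..B, ∫ v in A..B, G u * G v * |u - v| ^ (2*H*K - 2))) := by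
  obtain ⟨C, hC⟩ := hG_bdd
  have hC0 : 0 ≤ C := (abs_nonneg _).trans (hC 0)
  have hr : -1 < 2 * H * K - 2 := by linarith [hHK.1]
  have hgap : 0 < 2 - 2 * H * K := by linarith [hHK.2]
  have hAB : A ≤ B := by linarith
  set r : ℝ := 2 * H * K - 2 with hr_def
  set κ : ℝ := 2 ^ (1-K) * H * K * (2*H*K - 1)
  obtain ⟨M, hM⟩ := exists_bound_add_rpow_mul_rpow (2 * H) (K - 2) (2 * H - 1)
    (2 ^ (2-K) * H^2 * K * (K-1)) t ht
  set R : ℝ → ℝ → ℝ := fun x y =>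
    2 ^ (2-K) * H^2 * K * (K-1) * (y ^ (2*H) + x ^ (2*H)) ^ (K-2) * (x*y) ^ (2*H-1) with hR
  have hGG : ∀ u v, |G u * G v| ≤ C * C := fun u v => by
    rw [abs_mul]; exact mul_le_mul (hC u) (hC v) (abs_nonneg _) hC0
  have hsing_bound : ∀ u v, ‖G u * G v * |u - v| ^ r‖ ≤ C * C * |u - v| ^ r := fun u v => by
    rw [norm_mul, norm_of_nonneg (rpow_nonneg (abs_nonneg (u - v)) r)]
    exact mul_le_mul_of_nonneg_right (hGG u v) (rpow_nonneg (abs_nonneg _) _)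
  have hsing_meas : Measurable (Function.uncurry fun u v : ℝ => G u * G v * |u - v| ^ r) := by
    simp only [Function.uncurry_def]; fun_prop
  have hsing_inner : ∀ u, IntervalIntegrable (fun v => G u * G v * |u - v| ^ r) volume A B := by
    intro u
    refine ((intervalIntegrable_abs_sub_rpow hr u A B).const_mul (C * C)).mono_fun'
      (by fun_prop) (Eventually.of_forall fun v => hsing_bound u v)
  have hsing_outer : IntervalIntegrable
      (fun u => ∫ v in A..B, G u * G v * |u - v| ^ r) volume A B := by
    refine intervalIntegrable_integral_of_bounded hsing_meas hAB
      (M := C * C * ∫ w in (A - B)..(B - A), |w| ^ r) fun u hu => ?_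
    calc |∫ v in A..B, G u * G v * |u - v| ^ r|
        ≤ ∫ v in A..B, C * C * |u - v| ^ r := by
          rw [← norm_eq_abs]
          exact intervalIntegral.norm_integral_le_of_norm_le hAB
            (Eventually.of_forall fun v _ => hsing_bound u v)
            ((intervalIntegrable_abs_sub_rpow hr u A B).const_mul (C * C))
      _ ≤ _ := by
          rw [intervalIntegral.integral_const_mul]
          exact mul_le_mul_of_nonneg_left (integral_abs_sub_rpow_le hr hu) (by positivity)
  set J := ∫ u in A..B, ∫ v in A..B, G u * G v * |u - v| ^ r with hJ
  have hnear : ∀ᶠ φ : ℝ in nhdsWithin 0 (Set.Ioi 0),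
      0 < φ ∧ ∀ u ∈ Set.Icc A B, t + φ * u ∈ Set.Icc (t / 2) (2 * t) := by
    have hlimA : Tendsto (fun φ : ℝ => t + φ * A) (nhdsWithin 0 (Set.Ioi 0)) (nhds t) :=
      tendsto_nhdsWithin_of_tendsto_nhds <| by
        simpa using (show Continuous fun φ : ℝ => t + φ * A by fun_prop).tendsto 0
    have hlimB : Tendsto (fun φ : ℝ => t + φ * B) (nhdsWithin 0 (Set.Ioi 0)) (nhds t) :=
      tendsto_nhdsWithin_of_tendsto_nhds <| by
        simpa using (show Continuous fun φ : ℝ => t + φ * B by fun_prop).tendsto 0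
    filter_upwards [self_mem_nhdsWithin, hlimA.eventually_const_lt (half_lt_self ht),
      hlimB.eventually_lt_const (show t < 2 * t by linarith)] with φ hφ h1 h2
    have hφ' : 0 < φ := hφ
    refine ⟨hφ', fun u hu => ⟨?_, ?_⟩⟩
    · nlinarith [mul_le_mul_of_nonneg_left hu.1 hφ'.le]
    · nlinarith [mul_le_mul_of_nonneg_left hu.2 hφ'.le]
  have hsmall : Tendsto (fun φ : ℝ => φ ^ (2 - 2*H*K) * (C * C * M * (B - A) * (B - A)))
      (nhdsWithin 0 (Set.Ioi 0)) (nhds 0) := by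
    have h := (continuousAt_rpow_const 0 (2 - 2*H*K) (Or.inr hgap.le)).tendsto
    rw [zero_rpow hgap.ne'] at h
    simpa using (tendsto_nhdsWithin_of_tendsto_nhds h).mul_const _
  rw [tendsto_iff_norm_sub_tendsto_zero]
  refine squeeze_zero' (Eventually.of_forall fun _ => norm_nonneg _) ?_ hsmall
  filter_upwards [hnear] with φ hφ
  obtain ⟨hφ, hmem⟩ := hφ
  have hreg_meas : Measurable
      (Function.uncurry fun u v : ℝ => G u * G v * R (t + φ * u) (t + φ * v)) := by
    simp only [Function.uncurry_def, hR]; fun_prop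
  have hreg_bound : ∀ u ∈ Set.Icc A B, ∀ v ∈ Set.Icc A B,
      |G u * G v * R (t + φ * u) (t + φ * v)| ≤ C * C * M := by
    intro u hu v hv
    rw [abs_mul]
    exact mul_le_mul (hGG u v) (hM _ (hmem u hu) _ (hmem v hv)) (abs_nonneg _) (by positivity)
  have hreg_inner : ∀ u ∈ Set.Icc A B, IntervalIntegrable
      (fun v => G u * G v * R (t + φ * u) (t + φ * v)) volume A B := by
    intro u hu
    refine (intervalIntegrable_const (c := C * C * M)).mono_fun'
      (hreg_meas.of_uncurry_left (x := u)).aestronglyMeasurable ?_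
    rw [Set.uIoc_of_le hAB]
    filter_upwards [ae_restrict_mem measurableSet_Ioc] with v hv
    exact hreg_bound u hu v (Set.Ioc_subset_Icc_self hv)
  have hreg_inner_bound : ∀ u ∈ Set.Icc A B,
      |∫ v in A..B, G u * G v * R (t + φ * u) (t + φ * v)| ≤ C * C * M * (B - A) := by
    intro u hu
    rw [← norm_eq_abs, ← abs_of_nonneg (sub_nonneg.2 hAB)]
    refine intervalIntegral.norm_integral_le_of_norm_le_const fun v hv => ?_
    rw [Set.uIoc_of_le hAB] at hv
    exact hreg_bound u hu v (Set.Ioc_subset_Icc_self hv)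
  have hreg_outer := intervalIntegrable_integral_of_bounded hreg_meas hAB hreg_inner_bound
  have hinner : ∀ u ∈ Set.Icc A B,
      ∫ v in A..B, G u * G v * Q (t + φ * u) (t + φ * v)
        = (∫ v in A..B, G u * G v * R (t + φ * u) (t + φ * v))
          + κ * φ ^ r * ∫ v in A..B, G u * G v * |u - v| ^ r := by
    intro u hu
    rw [← intervalIntegral.integral_const_mul, ← intervalIntegral.integral_add (hreg_inner u hu)
      ((hsing_inner u).const_mul _)]
    refine intervalIntegral.integral_congr_ae ?_
    have hne : ∀ᵐ v : ℝ, v ≠ u := by simp [ae_iff]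
    filter_upwards [hne] with v hvu hv
    rw [Set.uIoc_of_le hAB] at hv
    have hu' := (hmem u hu).1
    have hv' := (hmem v (Set.Ioc_subset_Icc_self hv)).1
    have hne' : t + φ * u ≠ t + φ * v := fun h =>
      hvu (mul_left_cancel₀ hφ.ne' (add_left_cancel h)).symm
    have habs : |t + φ * v - (t + φ * u)| ^ r = φ ^ r * |u - v| ^ r := by
      rw [show t + φ * v - (t + φ * u) = φ * (v - u) by ring, abs_mul, abs_of_pos hφ,
        abs_sub_comm v u, mul_rpow hφ.le (abs_nonneg _)]
    rw [hQ _ _ (by linarith) (by linarith) hne', habs]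
    ring
  have houter : ∫ u in A..B, ∫ v in A..B, G u * G v * Q (t + φ * u) (t + φ * v)
      = (∫ u in A..B, ∫ v in A..B, G u * G v * R (t + φ * u) (t + φ * v))
        + κ * φ ^ r * J := by
    rw [hJ, ← intervalIntegral.integral_const_mul, ← intervalIntegral.integral_add hreg_outer
      (hsing_outer.const_mul _)]
    refine intervalIntegral.integral_congr fun u hu => ?_
    rw [Set.uIcc_of_le hAB] at hu
    exact hinner u hu
  have hcancel : φ ^ (2 - 2*H*K) * φ ^ r = 1 := by
    rw [← rpow_add hφ, hr_def, show 2 - 2*H*K + (2*H*K - 2) = 0 by ring, rpow_zero]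
  have hdiff : ∀ I : ℝ, φ ^ (2 - 2*H*K) * (I + κ * φ ^ r * J) - κ * J
      = φ ^ (2 - 2*H*K) * I := fun I => by linear_combination κ * J * hcancel
  rw [houter, hdiff, norm_mul, norm_of_nonneg (rpow_nonneg hφ.le _)]
  refine mul_le_mul_of_nonneg_left ?_ (rpow_nonneg hφ.le _)
  nth_rewrite 2 [← abs_of_nonneg (sub_nonneg.2 hAB)]
  refine intervalIntegral.norm_integral_le_of_norm_le_const fun u hu => ?_
  rw [Set.uIoc_of_le hAB] at hu
  exact hreg_inner_bound u (Set.Ioc_subset_Icc_self hu)
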